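/- Let 𝕏 be a real Hilbert space, 𝕁 a finite nonempty set, 𝕎 a set, {W_j}_{j∈𝕁} a family of pairwise disjoint subsets of 𝕎, and {θ_j}_{j∈𝕁} mappings θ_j : 𝕎 → 𝕏. Assume: (a) the linear span of ⋃_{j∈𝕁} θ_j(W_j) is all of 𝕏; (b) each set θ_j(W_j) is symmetric (−θ_j(W_j) = θ_j(W_j)) and weakly bounded; (c) h : 𝕎 → ℝ̄ is such that each (θ_j▷h)* is proper and ⋂_{j∈𝕁} dom((θ_j▷h)*) ≠ ∅, where (θ_j▷h)(x) = inf{h(w) : w ∈ W_j, θ_j(w) = x}. Then there exists a norm N on 𝕏 whose closed unit ball {x : N(x) ≤ 1} equals the closed convex hull of ⋃_{j∈𝕁} θ_j(W_j), such that the infimum of (sup_{j∈𝕁} (θ_j▷h)*)*' over {x : N(x) ≤ 1} is attained and min_{N(x) ≤ 1} (sup_{j∈𝕁} (θ_j▷h)*)*'(x) ≤ inf{ h(w) : w ∈ ⋃_{j∈𝕁} W_j }. -/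

import Mathlib

open scoped RealInnerProductSpace

/-- The Fenchel conjugate `(θⱼ▷h)*` of the restricted infimal postcomposition
`(θⱼ▷h)(x) = inf {h w : w ∈ Wⱼ, θⱼ w = x}` (with `inf ∅ = ⊤`), computed with the
Moreau lower addition, i.e. `EReal` addition (`⊤ + ⊥ = ⊥`). -/
noncomputable def pconj {X W' : Type*} [NormedAddCommGroup X] [InnerProductSpace ℝ X]
    (h : W' → EReal) (Wj : Set W') (θj : W' → X) (y : X) : EReal :=
  ⨆ x : X, ((⟪x, y⟫ : EReal) + (-(⨅ w ∈ {w | w ∈ Wj ∧ θj w = x}, h w)))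

/-- The reverse Fenchel conjugate `g*'(x) = ⨆ y, ⟪x,y⟫ + (− g y)`. -/
noncomputable def rconj {X : Type*} [NormedAddCommGroup X] [InnerProductSpace ℝ X]
    (g : X → EReal) (x : X) : EReal :=
  ⨆ y : X, ((⟪x, y⟫ : EReal) + (-(g y)))

/-- `N : X → ℝ` is a norm: nonnegative, definite, absolutely homogeneous, subadditive. -/
def IsNorm {X : Type*} [NormedAddCommGroup X] [InnerProductSpace ℝ X] (N : X → ℝ) : Prop :=
  (∀ x, 0 ≤ N x) ∧ (∀ x, N x = 0 ↔ x = 0) ∧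
  (∀ (c : ℝ) (x : X), N (c • x) = |c| * N x) ∧ (∀ x y, N (x + y) ≤ N x + N y)


lemma aux_rconj_min {X : Type*} [NormedAddCommGroup X] [InnerProductSpace ℝ X]
    [CompleteSpace X] (K : Set X) (hne : K.Nonempty) (hcl : IsClosed K) (hcv : Convex ℝ K)
    (R : ℝ) (hR : ∀ x ∈ K, ‖x‖ ≤ R) (g : X → EReal) :
    ∃ x₀ ∈ K, ∀ x ∈ K, rconj g x₀ ≤ rconj g x := by
  classical
  let φ : WeakDual ℝ X → X := fun f => (InnerProductSpace.toDual ℝ X).symm (WeakDual.toStrongDual f)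
  have hφ : ∀ f y, ⟪φ f, y⟫ = f y := fun f y => by
    simp only [φ, InnerProductSpace.toDual_symm_apply]; rfl
  have hsurj : ∀ x : X, ∃ f, φ f = x := fun x =>
    ⟨StrongDual.toWeakDual (InnerProductSpace.toDual ℝ X x), by simp [φ]⟩
  have hclosed : IsClosed (φ ⁻¹' K) := by
    have : φ ⁻¹' K = ⋂ y : X, ⋂ u : ℝ, ⋂ _ : ∀ a ∈ K, ⟪a, y⟫ ≤ u, {f : WeakDual ℝ X | f y ≤ u} := by
      ext f
      simp only [Set.mem_preimage, Set.mem_iInter, Set.mem_ofPred_eq]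
      constructor
      · intro hf y u hu
        rw [← hφ]; exact hu _ hf
      · intro H
        by_contra hf
        obtain ⟨l, u, h1, h2⟩ := geometric_hahn_banach_closed_point hcv hcl hf
        have hl : ∀ z, ⟪z, (InnerProductSpace.toDual ℝ X).symm l⟫ = l z := fun z => by
          rw [real_inner_comm, InnerProductSpace.toDual_symm_apply]
        have := H ((InnerProductSpace.toDual ℝ X).symm l) u (fun a ha => by
          rw [hl]; exact (h1 a ha).le)
        rw [← hφ, hl] at this
        linarith
    rw [this]
    refine isClosed_iInter fun y => isClosed_iInter fun u => isClosed_iInter fun _ => ?_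
    exact isClosed_le (WeakDual.eval_continuous y) continuous_const
  have hcomp : IsCompact (φ ⁻¹' K) := by
    refine (WeakDual.isCompact_closedBall (𝕜 := ℝ) (E := X) 0 R).of_isClosed_subset hclosed ?_
    intro f hf
    have := hR _ hf
    simpa [φ] using this
  have hlsc : LowerSemicontinuous (fun f => rconj g (φ f)) := by
    unfold rconj
    refine lowerSemicontinuous_iSup fun y => ?_
    simp only [hφ]
    have hc : Continuous fun f : WeakDual ℝ X => ((f y : ℝ) : EReal) :=
      continuous_coe_real_ereal.comp (WeakDual.eval_continuous y)
    generalize -(g y) = c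
    induction c with
    | bot => simpa using lowerSemicontinuous_const
    | top => simpa using lowerSemicontinuous_const
    | coe r =>
      refine Continuous.lowerSemicontinuous ?_
      have : Continuous fun f : WeakDual ℝ X => ((f y + r : ℝ) : EReal) :=
        continuous_coe_real_ereal.comp ((WeakDual.eval_continuous y).add continuous_const)
      simpa using this
  obtain ⟨x, hx⟩ := hne
  obtain ⟨f, rfl⟩ := hsurj x
  obtain ⟨f₀, h0, hmin⟩ := LowerSemicontinuousOn.exists_isMinOn ⟨f, hx⟩ hcomp
    (hlsc.lowerSemicontinuousOn _)
  refine ⟨φ f₀, h0, fun x hx => ?_⟩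
  obtain ⟨f, rfl⟩ := hsurj x
  exact hmin hx

lemma aux_bdd {X : Type*} [NormedAddCommGroup X] [InnerProductSpace ℝ X]
    [CompleteSpace X] (S : Set X) (hS : -S = S)
    (hwb : ∀ y : X, (⨆ x ∈ S, (⟪x, y⟫ : EReal)) < ⊤) : ∃ R : ℝ, ∀ x ∈ S, ‖x‖ ≤ R := by
  have key : ∀ y : X, ∃ C, ∀ x : S, ‖InnerProductSpace.toDual ℝ X (x : X) y‖ ≤ C := by
    intro y
    obtain ⟨C, hC, -⟩ := EReal.lt_iff_exists_real_btwn.1 (hwb y)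
    have hle : ∀ x ∈ S, ⟪x, y⟫ ≤ C := fun x hx => by
      have : (⟪x, y⟫ : EReal) ≤ C := (le_iSup₂ (f := fun x (_ : x ∈ S) => (⟪x, y⟫ : EReal)) x hx).trans hC.le
      exact_mod_cast this
    refine ⟨C, fun x => ?_⟩
    rw [InnerProductSpace.toDual_apply_apply, Real.norm_eq_abs, abs_le]
    have h1 := hle x x.2
    have h2 := hle (-x) (hS.subset (Set.neg_mem_neg.2 x.2))
    rw [inner_neg_left] at h2
    constructor <;> linarith
  obtain ⟨R, hR⟩ := banach_steinhaus key
  exact ⟨R, fun x hx => by simpa using hR ⟨x, hx⟩⟩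

lemma aux_absorb {X : Type*} [NormedAddCommGroup X] [InnerProductSpace ℝ X]
    (C S : Set X) (hC : Convex ℝ C) (h0 : (0 : X) ∈ C) (hb : Balanced ℝ C) (hSC : S ⊆ C)
    (hspan : Submodule.span ℝ S = ⊤) : Absorbent ℝ C := by
  have key : ∀ x : X, ∃ r : ℝ, 0 < r ∧ r • x ∈ C := by
    intro x
    have hx : x ∈ Submodule.span ℝ S := by rw [hspan]; trivial
    induction hx using Submodule.span_induction with
    | mem x hx => exact ⟨1, one_pos, by simpa using hSC hx⟩
    | zero => exact ⟨1, one_pos, by simpa using h0⟩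
    | add x y _ _ hx hy =>
      obtain ⟨r, hr, hrx⟩ := hx
      obtain ⟨s, hs, hsy⟩ := hy
      refine ⟨r * s / (r + s), by positivity, ?_⟩
      have := hC hrx hsy (a := s / (r + s)) (b := r / (r + s)) (by positivity) (by positivity)
        (by field_simp; ring)
      convert this using 1
      rw [smul_smul, smul_smul, smul_add]
      congr 2 <;> ring
    | smul a x _ hx =>
      obtain ⟨r, hr, hrx⟩ := hx
      by_cases ha : a = 0
      · exact ⟨1, one_pos, by simpa [ha] using h0⟩
      · refine ⟨r / |a|, by positivity, ?_⟩
        rw [smul_smul]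
        refine hb.smul_mem_mono hrx ?_
        rw [norm_mul, norm_div, Real.norm_eq_abs a, Real.norm_eq_abs |a|, abs_abs,
          div_mul_cancel₀ _ (by positivity)]
  rw [absorbent_iff_eventually_nhdsNE_zero]
  intro x
  obtain ⟨r, hr, hrx⟩ := key x
  refine Filter.Eventually.filter_mono nhdsWithin_le_nhds ?_
  filter_upwards [Metric.ball_mem_nhds (0 : ℝ) hr] with c hc
  refine hb.smul_mem_mono hrx ?_
  rw [Real.norm_of_nonneg hr.le]
  simpa using (mem_ball_zero_iff.1 hc).le

lemma aux_rconj_le {X W' J : Type*} [NormedAddCommGroup X] [InnerProductSpace ℝ X]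
    (W : J → Set W') (θ : J → W' → X) (h : W' → EReal) (j : J) (w : W') (hw : w ∈ W j) :
    rconj (fun y => ⨆ j : J, pconj h (W j) (θ j) y) (θ j w) ≤ h w := by
  have h1 : (⨅ v ∈ {v | v ∈ W j ∧ θ j v = θ j w}, h v) ≤ h w :=
    iInf₂_le w ⟨hw, rfl⟩
  refine iSup_le fun y => le_trans ?_ h1
  have h2 : (⟪θ j w, y⟫ : EReal) + (-(⨅ v ∈ {v | v ∈ W j ∧ θ j v = θ j w}, h v)) ≤
      ⨆ j : J, pconj h (W j) (θ j) y :=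
    le_trans (le_iSup (fun x : X => (⟪x, y⟫ : EReal) +
      (-(⨅ v ∈ {v | v ∈ W j ∧ θ j v = x}, h v))) (θ j w))
      (le_iSup (fun j : J => pconj h (W j) (θ j) y) j)
  refine le_trans (add_le_add le_rfl (EReal.neg_le_neg_iff.2 h2)) ?_
  generalize (⨅ v ∈ {v | v ∈ W j ∧ θ j v = θ j w}, h v) = i
  generalize (⟪θ j w, y⟫ : ℝ) = a
  induction i with
  | bot => simp
  | top => simp
  | coe r =>
    have : a + -(a + -r) = r := by ring
    exact_mod_cast this.le

/-- `𝕏` a real Hilbert space, `𝕁` finite nonempty, `{W_j}` pairwise disjoint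
subsets of a set `𝕎`, `θ_j : 𝕎 → 𝕏` with `span (⋃_j θ_j(W_j)) = 𝕏`, each `θ_j(W_j)`
symmetric and weakly bounded, each `(θ_j▷h)*` proper with common nonempty domain.
Then there exists a norm `N` on `𝕏` whose closed unit ball is the closed convex hull of
`⋃_j θ_j(W_j)`, such that the infimum of `(sup_j (θ_j▷h)*)*'` over this unit ball is
attained and is `≤ inf { h w : w ∈ ⋃_j W_j }`. -/
theorem stmt_6 {X W' J : Type*} [NormedAddCommGroup X] [InnerProductSpace ℝ X]
    [CompleteSpace X] [Fintype J] [Nonempty J]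
    (W : J → Set W') (θ : J → W' → X)
    (hdisj : Pairwise fun j j' : J => Disjoint (W j) (W j'))
    (hspan : Submodule.span ℝ (⋃ j : J, θ j '' W j) = ⊤)
    (hsymm : ∀ j : J, -(θ j '' W j) = θ j '' W j)
    (hwb : ∀ j : J, ∀ y : X, (⨆ x ∈ θ j '' W j, (⟪x, y⟫ : EReal)) < ⊤)
    (h : W' → EReal)
    (hproper : ∀ j : J,
      (∀ y : X, pconj h (W j) (θ j) y ≠ ⊥) ∧ ∃ y : X, pconj h (W j) (θ j) y ≠ ⊤)
    (hdom : ∃ y : X, ∀ j : J, pconj h (W j) (θ j) y ≠ ⊤) :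
    ∃ N : X → ℝ, IsNorm N ∧
      {x : X | N x ≤ 1} = closure (convexHull ℝ (⋃ j : J, θ j '' W j)) ∧
      ∃ x₀ : X, N x₀ ≤ 1 ∧
        (∀ x : X, N x ≤ 1 →
          rconj (fun y => ⨆ j : J, pconj h (W j) (θ j) y) x₀
            ≤ rconj (fun y => ⨆ j : J, pconj h (W j) (θ j) y) x) ∧
        rconj (fun y => ⨆ j : J, pconj h (W j) (θ j) y) x₀ ≤ ⨅ w ∈ ⋃ j : J, W j, h w := by
  classical
  set S : Set X := ⋃ j : J, θ j '' W j with hS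
  have hSsymm : -S = S := by
    rw [hS, Set.iUnion_neg]
    exact Set.iUnion_congr hsymm
  choose R hR using fun j => aux_bdd (θ j '' W j) (hsymm j) (hwb j)
  have hSne : S.Nonempty := by
    obtain ⟨j⟩ := ‹Nonempty J›
    by_contra hne
    rw [Set.not_nonempty_iff_eq_empty] at hne
    have hWj : W j = ∅ := by
      rw [hS, Set.iUnion_eq_empty] at hne
      simpa using hne j
    refine (hproper j).1 0 ?_
    simp [pconj, hWj]
  set C := convexHull ℝ S with hCdef
  set K := closure C with hK
  have hCc : Convex ℝ C := convex_convexHull ℝ S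
  have hCsymm : -C = C := by rw [hCdef, ← convexHull_neg, hSsymm]
  have hCb : Balanced ℝ C := (balanced_iff_neg_mem hCc).2 fun x hx => by
    rw [← hCsymm]; simpa using hx
  have hSC : S ⊆ C := subset_convexHull ℝ S
  have hC0 : (0 : X) ∈ C := hCb.zero_mem (hSne.mono hSC)
  have hCabs : Absorbent ℝ C := aux_absorb C S hCc hC0 hCb hSC hspan
  have hCK : C ⊆ K := subset_closure
  have hKc : Convex ℝ K := hCc.closure
  have hKb : Balanced ℝ K := hCb.closure
  have hKabs : Absorbent ℝ K := hCabs.mono hCK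
  have hKR : ∀ x ∈ K, ‖x‖ ≤ ∑ j, |R j| := by
    have h1 : S ⊆ Metric.closedBall 0 (∑ j, |R j|) := by
      intro x hx
      obtain ⟨j, hj⟩ := Set.mem_iUnion.1 hx
      rw [mem_closedBall_zero_iff]
      exact (hR j x hj).trans ((le_abs_self _).trans
        (Finset.single_le_sum (f := fun j => |R j|) (fun i _ => abs_nonneg _) (Finset.mem_univ j)))
    have h2 : K ⊆ Metric.closedBall 0 (∑ j, |R j|) :=
      closure_minimal (convexHull_min h1 (convex_closedBall _ _)) Metric.isClosed_closedBall
    exact fun x hx => by simpa using h2 hx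
  have hKvb : Bornology.IsVonNBounded ℝ K := by
    rw [NormedSpace.isVonNBounded_iff, isBounded_iff_forall_norm_le]
    exact ⟨_, hKR⟩
  have hball : ∀ x, gauge K x ≤ 1 ↔ x ∈ K := fun x =>
    ⟨fun hx => by
      simpa [hK] using mem_closure_of_gauge_le_one hKc (hCK hC0) hKabs hx, gauge_le_one_of_mem⟩
  refine ⟨gauge K, ⟨fun x => gauge_nonneg x, fun x => gauge_eq_zero hKabs hKvb,
    fun c x => by rw [gauge_smul hKb, Real.norm_eq_abs], gauge_add_le hKc hKabs⟩,
    Set.ext hball, ?_⟩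
  obtain ⟨x₀, hx₀, hmin⟩ := aux_rconj_min K ⟨0, hCK hC0⟩ isClosed_closure hKc _ hKR
    (fun y => ⨆ j : J, pconj h (W j) (θ j) y)
  refine ⟨x₀, (hball _).2 hx₀, fun x hx => hmin x ((hball x).1 hx), ?_⟩
  refine le_iInf₂ fun w hw => ?_
  obtain ⟨j, hj⟩ := Set.mem_iUnion.1 hw
  exact (hmin _ (hCK (hSC (Set.mem_iUnion.2 ⟨j, w, hj, rfl⟩)))).trans
    (aux_rconj_le W θ h j w hj)
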